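/- Let K be a field of characteristic zero, A = K[u_1,…,u_s,v_1,…,v_t], A' = K[u'_1,…,u'_{s+1},v'_2,…,v'_t], n := s+t, and fix 1 ≤ k ≤ s and 1 ≤ l ≤ t. Let φ : A → A' be the K-algebra homomorphism with φ(u_i)=u'_i·u'_{s+1} for i ≤ k, φ(u_i)=u'_i for k < i ≤ s, φ(v_1)=u'_{s+1}, φ(v_j)=u'_{s+1}·v'_j for 2 ≤ j ≤ l, and φ(v_j)=v'_j for j > l (the v_1-chart of the admissible blowing-up with centre (u_1=⋯=u_k=v_1=⋯=v_l=0)). Then for any σ_1,…,σ_N ∈ A, the ideal of n×n minors of the logarithmic Jacobian matrix of (φ(σ_1),…,φ(σ_N)) (taken in A', with u'_1,…,u'_{s+1} as the exceptional variables and v'_2,…,v'_t as the remaining variables) equals the product of the principal ideal generated by (u'_{s+1})^l with the extension under φ of the ideal of n×n minors of the logarithmic Jacobian matrix of (σ_1,…,σ_N). (Chart form of Lemma 2.6(1).) -/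

import Mathlib

open Matrix MvPolynomial

/-- The ideal of `r × r` minors of a matrix: the ideal generated by the determinants of all
`r × r` submatrices (obtained by selecting `r` rows and `r` columns). -/
def minorsIdeal {R : Type*} [CommRing R] {m c : Type*} (r : ℕ)
    (M : Matrix m c R) : Ideal R :=
  Ideal.span { d | ∃ (f : Fin r → m) (g : Fin r → c), d = (M.submatrix f g).det }

/-- The logarithmic Jacobian matrix of `σ_1, …, σ_N ∈ K[u_1,…,u_s,v_1,…,v_t]`:
the `N × (s+t)` matrix whose `i`-th row is
`(u_1·∂σ_i/∂u_1, …, u_s·∂σ_i/∂u_s, ∂σ_i/∂v_1, …, ∂σ_i/∂v_t)`. -/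
noncomputable def logJac {K : Type*} [Field K] {s t N : ℕ}
    (σ : Fin N → MvPolynomial (Fin s ⊕ Fin t) K) :
    Matrix (Fin N) (Fin s ⊕ Fin t) (MvPolynomial (Fin s ⊕ Fin t) K) :=
  Matrix.of fun i j =>
    match j with
    | Sum.inl p => X (Sum.inl p) * pderiv (Sum.inl p) (σ i)
    | Sum.inr q => pderiv (Sum.inr q) (σ i)

/-- The `v_1`-chart of the admissible blowing-up with centre
`(u_1 = ⋯ = u_k = v_1 = ⋯ = v_l = 0)`: the `K`-algebra homomorphism
`K[u_1,…,u_s,v_1,…,v_t] → K[u'_1,…,u'_{s+1},v'_2,…,v'_t]` with `φ(u_i) = u'_i·u'_{s+1}`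
for `i ≤ k`, `φ(u_i) = u'_i` for `k < i ≤ s`, `φ(v_1) = u'_{s+1}`,
`φ(v_j) = u'_{s+1}·v'_j` for `2 ≤ j ≤ l`, and `φ(v_j) = v'_j` for `j > l`. -/
noncomputable def blowupChartV (K : Type*) [Field K] (s t k l : ℕ) :
    MvPolynomial (Fin s ⊕ Fin t) K →ₐ[K] MvPolynomial (Fin (s + 1) ⊕ Fin (t - 1)) K :=
  aeval fun x =>
    match x with
    | Sum.inl i =>
        if i.val < k then X (Sum.inl i.castSucc) * X (Sum.inl (Fin.last s))
        else X (Sum.inl i.castSucc)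
    | Sum.inr j =>
        if h : j.val = 0 then X (Sum.inl (Fin.last s))
        else if j.val < l then
          X (Sum.inl (Fin.last s)) *
            X (Sum.inr (⟨j.val - 1, by have := j.isLt; omega⟩ : Fin (t - 1)))
        else X (Sum.inr (⟨j.val - 1, by have := j.isLt; omega⟩ : Fin (t - 1)))

section MinorsIdeal

variable {R S m c c' : Type*} [CommRing R] [CommRing S]

theorem minorsIdeal_map (φ : R →+* S) (r : ℕ) (M : Matrix m c R) :
    minorsIdeal r (M.map φ) = (minorsIdeal r M).map φ := by
  unfold minorsIdeal
  rw [Ideal.map_span]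
  congr 1
  ext d
  simp only [Set.mem_ofPred_eq, Set.mem_image, Matrix.submatrix_map]
  constructor
  · rintro ⟨f, g, rfl⟩
    exact ⟨_, ⟨f, g, rfl⟩, by rw [RingHom.map_det]; rfl⟩
  · rintro ⟨_, ⟨f, g, rfl⟩, rfl⟩
    exact ⟨f, g, by rw [RingHom.map_det]; rfl⟩

theorem minorsIdeal_submatrix_equiv (r : ℕ) (M : Matrix m c R) (e : c' ≃ c) :
    minorsIdeal r (M.submatrix id e) = minorsIdeal r M := by
  unfold minorsIdeal
  congr 1
  ext d
  constructor
  · rintro ⟨f, g, rfl⟩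
    exact ⟨f, e ∘ g, rfl⟩
  · rintro ⟨f, g, rfl⟩
    refine ⟨f, e.symm ∘ g, ?_⟩
    congr 1
    ext i j
    simp

theorem minorsIdeal_mul_square [Fintype c] [DecidableEq c] {r : ℕ} (hr : Fintype.card c = r)
    (A : Matrix m c R) (C : Matrix c c R) :
    minorsIdeal r (A * C) = Ideal.span {C.det} * minorsIdeal r A := by
  have bijective_of {g : Fin r → c} (hg : Function.Injective g) : Function.Bijective g :=
    (Fintype.bijective_iff_injective_and_card g).2 ⟨hg, by simp [hr]⟩
  have det_mul_submatrix (f : Fin r → m) (e : Fin r ≃ c) :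
      ((A * C).submatrix f e).det = C.det * (A.submatrix f e).det := by
    rw [← Matrix.submatrix_mul_equiv A C f e e, Matrix.det_mul, Matrix.det_submatrix_equiv_self,
      mul_comm]
  have det_eq_zero {B : Matrix m c R} (f : Fin r → m) {g : Fin r → c}
      (hg : ¬ Function.Injective g) : (B.submatrix f g).det = 0 := by
    simp only [Function.Injective, not_forall] at hg
    obtain ⟨i, j, hij, hne⟩ := hg
    exact Matrix.det_zero_of_column_eq hne fun a => by simp [hij]
  unfold minorsIdeal
  rw [Ideal.span_mul_span']
  apply le_antisymm <;> rw [Ideal.span_le]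
  · rintro _ ⟨f, g, rfl⟩
    by_cases hg : Function.Injective g
    · refine Ideal.subset_span ?_
      exact Set.mem_mul.2 ⟨_, rfl, _, ⟨f, g, rfl⟩,
        (det_mul_submatrix f (Equiv.ofBijective g (bijective_of hg))).symm⟩
    · rw [det_eq_zero f hg]
      exact Ideal.zero_mem _
  · rintro _ ⟨_, rfl, _, ⟨f, g, rfl⟩, rfl⟩
    by_cases hg : Function.Injective g
    · exact Ideal.subset_span
        ⟨f, g, (det_mul_submatrix f (Equiv.ofBijective g (bijective_of hg))).symm⟩
    · simp [det_eq_zero f hg]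

end MinorsIdeal

theorem MvPolynomial.derivation_aeval {R A ι : Type*} [CommRing R] [CommRing A] [Algebra R A]
    [Fintype ι] (D : Derivation R A A) (g : ι → A) (p : MvPolynomial ι R) :
    D (aeval g p) = ∑ i, aeval g (pderiv i p) * D (g i) := by
  classical
  induction p using MvPolynomial.induction_on with
  | C a => simp
  | add p q hp hq => simp [hp, hq, add_mul, Finset.sum_add_distrib]
  | mul_X p j hp =>
    simp only [map_mul, map_add, aeval_X, Derivation.leibniz, hp, smul_eq_mul, pderiv_X, add_mul,
      Finset.sum_add_distrib, Finset.mul_sum]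
    congr 1
    · simp [Pi.single_apply, apply_ite]
    · exact Finset.sum_congr rfl fun i _ => by ring

/-- The bijection between the original variables and those of the `v_1`-chart: `v_1`
corresponds to the new exceptional variable. -/
noncomputable def chartEquiv (s t : ℕ) : Fin s ⊕ Fin (t + 1) ≃ Fin (s + 1) ⊕ Fin t :=
  Equiv.ofBijective
    (Sum.elim (fun i => Sum.inl i.castSucc)
      (Fin.cases (Sum.inl (Fin.last s)) fun j => Sum.inr j)) <| by
    refine (Fintype.bijective_iff_injective_and_card _).2 ⟨?_, by simp; omega⟩
    rintro (i | i) (j | j)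
    · simp
    · induction j using Fin.cases <;> simp [Fin.castSucc_ne_last]
    · induction i using Fin.cases <;> simp [(Fin.castSucc_ne_last _).symm]
    · induction i using Fin.cases <;> induction j using Fin.cases <;> simp

section Chart

variable (K : Type*) [Field K] (s t k l : ℕ)

/-- The logarithmic derivation belonging to a variable of the chart. -/
noncomputable def logDerivation : Fin (s + 1) ⊕ Fin t →
    Derivation K (MvPolynomial (Fin (s + 1) ⊕ Fin t) K) (MvPolynomial (Fin (s + 1) ⊕ Fin t) K) :=
  Sum.elim (fun p => (X (Sum.inl p) : MvPolynomial (Fin (s + 1) ⊕ Fin t) K) • pderiv (Sum.inl p))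
    fun q => pderiv (Sum.inr q)

/-- The images of the variables in the `v_1`-chart. -/
noncomputable def chartVar :
    Fin s ⊕ Fin (t + 1) → MvPolynomial (Fin (s + 1) ⊕ Fin t) K :=
  Sum.elim
    (fun i => if i.val < k then X (Sum.inl i.castSucc) * X (Sum.inl (Fin.last s))
      else X (Sum.inl i.castSucc))
    (Fin.cases (X (Sum.inl (Fin.last s))) fun j =>
      if j.val + 1 < l then X (Sum.inl (Fin.last s)) * X (Sum.inr j) else X (Sum.inr j))

theorem blowupChartV_eq_aeval :
    blowupChartV K s (t + 1) k l = aeval (chartVar K s t k l) := by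
  unfold blowupChartV
  congr 1
  funext x
  rcases x with i | j
  · rfl
  · induction j using Fin.cases <;> rfl

/-- The diagonal part of the matrix relating the logarithmic Jacobian matrices. -/
noncomputable def chartDiag :
    Fin s ⊕ Fin (t + 1) → MvPolynomial (Fin (s + 1) ⊕ Fin t) K :=
  Sum.elim (fun _ => 1) fun j => if j.val < l then X (Sum.inl (Fin.last s)) else 1

/-- The off-diagonal entries, before scaling by `chartDiag`, of the column of the transition
matrix belonging to the new exceptional variable. -/
noncomputable def chartCol :
    Fin s ⊕ Fin (t + 1) → MvPolynomial (Fin (s + 1) ⊕ Fin t) K :=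
  Sum.elim (fun i => if i.val < k then 1 else 0)
    (Fin.cases 0 fun j => if j.val + 1 < l then X (Sum.inr j) else 0)

/-- The matrix relating the logarithmic Jacobian matrices of `σ` and of `φ ∘ σ`. -/
noncomputable def chartMatrix :
    Matrix (Fin s ⊕ Fin (t + 1)) (Fin s ⊕ Fin (t + 1))
      (MvPolynomial (Fin (s + 1) ⊕ Fin t) K) :=
  Matrix.diagonal (chartDiag K s t l) *
    (1 + Matrix.of fun b b' => if b' = Sum.inr 0 then chartCol K s t k l b else 0)

theorem det_chartMatrix (hl : l ≤ t + 1) :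
    (chartMatrix K s t k l).det = X (Sum.inl (Fin.last s)) ^ l := by
  rw [chartMatrix, Matrix.det_mul, Matrix.det_diagonal,
    Matrix.det_eq_of_forall_row_eq_smul_add_const (B := 1) (chartCol K s t k l) (Sum.inr 0) rfl
      fun _ _ => by simp [Matrix.one_apply, eq_comm]]
  simp [chartDiag, Finset.prod_ite, Fin.card_filter_val_lt, hl]

theorem logDerivation_chartVar (hl : 1 ≤ l) (b b' : Fin s ⊕ Fin (t + 1)) :
    logDerivation K s t (chartEquiv s t b') (chartVar K s t k l b) =
      Sum.elim (fun i => chartVar K s t k l (Sum.inl i)) (fun _ => 1) b *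
        chartMatrix K s t k l b b' := by
  have hl' : 0 < l := hl
  simp only [chartMatrix, Matrix.diagonal_mul, Matrix.add_apply, Matrix.of_apply]
  rcases b with i | j <;> rcases b' with i' | j' <;> try induction j using Fin.cases
  all_goals try induction j' using Fin.cases
  all_goals
    simp [logDerivation, chartEquiv, chartVar, chartDiag, chartCol, Matrix.one_apply, hl',
      (Fin.succ_ne_zero _).symm]
  all_goals try split_ifs
  all_goals simp_all [pderiv_X, Fin.castSucc_ne_last, mul_comm]

theorem logJac_chartVar {K : Type*} [Field K] {s t N : ℕ} (k l : ℕ) (hl : 1 ≤ l)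
    (σ : Fin N → MvPolynomial (Fin s ⊕ Fin (t + 1)) K) :
    (logJac fun i => aeval (chartVar K s t k l) (σ i)).submatrix id (chartEquiv s t) =
      (logJac σ).map (aeval (R := K) (chartVar K s t k l)) * chartMatrix K s t k l := by
  ext1 a b'
  rw [Matrix.mul_apply]
  trans logDerivation K s t (chartEquiv s t b') (aeval (chartVar K s t k l) (σ a))
  · simp only [logJac, Matrix.submatrix_apply, Matrix.of_apply]
    rcases chartEquiv s t b' with p | q <;> rfl
  rw [MvPolynomial.derivation_aeval]
  refine Finset.sum_congr rfl fun b _ => ?_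
  rw [logDerivation_chartVar K s t k l hl]
  rcases b with i | j
  · simp only [logJac, Matrix.map_apply, Matrix.of_apply, map_mul, aeval_X, Sum.elim_inl]
    ring
  · simp [logJac]

end Chart

/-- In the `v_1`-chart of an admissible blowing-up with centre
`(u_1 = ⋯ = u_k = v_1 = ⋯ = v_l = 0)`, the ideal of `n × n` minors (`n = s + t`) of the
logarithmic Jacobian matrix of `φ ∘ σ` equals `(u'_{s+1})^l` times the extension of the
ideal of `n × n` minors of the logarithmic Jacobian matrix of `σ`. -/
theorem minors_logJac_admissible_chart {K : Type*} [Field K] [CharZero K]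
    {s t N : ℕ} (k l : ℕ) (hk1 : 1 ≤ k) (hks : k ≤ s) (hl1 : 1 ≤ l) (hlt : l ≤ t)
    (σ : Fin N → MvPolynomial (Fin s ⊕ Fin t) K) :
    minorsIdeal (s + t) (logJac fun i => blowupChartV K s t k l (σ i)) =
      Ideal.span {(X (Sum.inl (Fin.last s)) : MvPolynomial (Fin (s + 1) ⊕ Fin (t - 1)) K) ^ l} *
        Ideal.map (blowupChartV K s t k l) (minorsIdeal (s + t) (logJac σ)) := by
  obtain ⟨t, rfl⟩ : ∃ t', t = t' + 1 := ⟨t - 1, by omega⟩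
  rw [blowupChartV_eq_aeval]
  change minorsIdeal (s + (t + 1)) (logJac fun i => aeval (chartVar K s t k l) (σ i)) =
    Ideal.span {(X (Sum.inl (Fin.last s)) : MvPolynomial (Fin (s + 1) ⊕ Fin t) K) ^ l} *
      Ideal.map (aeval (R := K) (chartVar K s t k l)).toRingHom _
  rw [← minorsIdeal_submatrix_equiv _ _ (chartEquiv s t), logJac_chartVar k l hl1 σ,
    minorsIdeal_mul_square (by simp), det_chartMatrix K s t k l hlt, ← minorsIdeal_map]
  rfl
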